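/- arXiv:solv-int/9410001 — 5 statements merged into one kernel-verified Lean document; each statement's English description precedes it below -/
import Mathlib

section
/- Let A be a star ring, let G and R be units of A, and let L be an element of A satisfying the constraint star(L) * star(R) = R * L. If the gauge operator G satisfies R * G = (star G)⁻¹ * R (where star G is the unit with underlying element star of G), then the conjugated element L̂ = G * L * G⁻¹ satisfies the same constraint: star(L̂) * star(R) = R * L̂. -/
/-- If `L` satisfies the reduction constraint `L† R† = R L` and the gauge unit `G`
satisfies `R G = (G†)⁻¹ R`, then the conjugated element `L̂ = G L G⁻¹`
satisfies the same constraint. -/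
theorem gauge_preserves_reduction_constraint {A : Type*} [Ring A] [StarRing A]
    (G R : Aˣ) (L : A)
    (hL : star L * star (R : A) = (R : A) * L)
    (hG : (R : A) * (G : A) = (↑(star G)⁻¹ : A) * (R : A)) :
    star ((G : A) * L * (↑G⁻¹ : A)) * star (R : A) =
      (R : A) * ((G : A) * L * (↑G⁻¹ : A)) := by
  have hG' : star (G : A) * star (R : A) = star (R : A) * (↑G⁻¹ : A) := by
    have h := congrArg star hG
    rw [star_mul, star_mul, ← Units.coe_star (star G)⁻¹, star_inv, star_star] at h
    exact h
  calc star ((G : A) * L * (↑G⁻¹ : A)) * star (R : A)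
      = star (↑G⁻¹ : A) * (star L * (star (G : A) * star (R : A))) := by
        simp only [star_mul, mul_assoc]
    _ = star (↑G⁻¹ : A) * (R : A) * (L * (↑G⁻¹ : A)) := by
        rw [hG', ← mul_assoc (star L), hL]
        simp only [mul_assoc]
    _ = (R : A) * ((G : A) * L * (↑G⁻¹ : A)) := by
        rw [← Units.coe_star_inv, ← hG]
        simp only [mul_assoc]
end

section
/- Let u, θ, ψ, Ω : ℝ → ℝ be infinitely differentiable, let μ, λ ∈ ℝ with λ ≠ μ, and suppose: θ'' + uθ = μθ; ψ'' + uψ = λψ; Ω' = θ²; and Ω(x) ≠ 0 for all x. Define W = (θψ' - θ'ψ)/(λ - μ), the transformed potential û = u + 2·(θ²/Ω)', and the binary Darboux transform ψ̂ = ψ - θ·W/Ω. Then ψ̂'' + û·ψ̂ = λ·ψ̂. Moreover û is again real-valued, so the transformed Schrödinger operator ∂² + û is again formally self-adjoint. -/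
theorem iteratedDeriv_two_eq_of_hasDerivAt {f f' : ℝ → ℝ} {f'' x : ℝ}
    (hf : ∀ y, HasDerivAt f (f' y) y) (hf' : HasDerivAt f' f'' x) :
    iteratedDeriv 2 f x = f'' := by
  rw [iteratedDeriv_succ, iteratedDeriv_one, funext fun y => (hf y).deriv, hf'.deriv]

theorem ContDiff.hasDerivAt_deriv_iteratedDeriv_two {f : ℝ → ℝ} (hf : ContDiff ℝ 2 f) (x : ℝ) :
    HasDerivAt (deriv f) (iteratedDeriv 2 f x) x := by
  rw [iteratedDeriv_succ, iteratedDeriv_one]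
  have h := hf.differentiable_iteratedDeriv 1 (by norm_num)
  rw [iteratedDeriv_one] at h
  exact (h x).hasDerivAt

/-- The normalized Wronskian of two Schrödinger eigenfunctions with distinct eigenvalues is an
antiderivative of their product. -/
theorem hasDerivAt_wronskian_div {u θ ψ : ℝ → ℝ} {μ lam : ℝ} (hne : lam ≠ μ)
    (hθ : ContDiff ℝ 2 θ) (hψ : ContDiff ℝ 2 ψ)
    (hθeq : ∀ x, iteratedDeriv 2 θ x + u x * θ x = μ * θ x)
    (hψeq : ∀ x, iteratedDeriv 2 ψ x + u x * ψ x = lam * ψ x) (x : ℝ) :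
    HasDerivAt (fun y => (θ y * deriv ψ y - deriv θ y * ψ y) / (lam - μ)) (θ x * ψ x) x := by
  have hθ' := (hθ.differentiable two_ne_zero x).hasDerivAt
  have hψ' := (hψ.differentiable two_ne_zero x).hasDerivAt
  refine (((hθ'.mul (hψ.hasDerivAt_deriv_iteratedDeriv_two x)).sub
    ((hθ.hasDerivAt_deriv_iteratedDeriv_two x).mul hψ')).div_const (lam - μ)).congr_deriv ?_
  rw [div_eq_iff (sub_ne_zero.mpr hne)]
  linear_combination θ x * hψeq x - ψ x * hθeq x


/-- Binary Darboux transformation for the self-adjoint Schrödinger operator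
`L = ∂² + u` with real potential.  Given real solutions `θ'' + uθ = μθ`,
`ψ'' + uψ = λψ` (`λ ≠ μ`), a nonvanishing potential `Ω` with `Ω' = θ²`, the
function `ψ̂ = ψ - θW/Ω` with `W = (θψ' - θ'ψ)/(λ-μ)` satisfies
`ψ̂'' + ûψ̂ = λψ̂` where `û = u + 2(θ²/Ω)'`.  All data being real, the
transformed potential `û` is again real, so `∂² + û` is again formally
self-adjoint. -/
theorem binary_darboux_schrodinger (u θ ψ Ω : ℝ → ℝ)
    (hu : ContDiff ℝ (⊤ : ℕ∞) u) (hθ : ContDiff ℝ (⊤ : ℕ∞) θ) (hψ : ContDiff ℝ (⊤ : ℕ∞) ψ)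
    (hΩs : ContDiff ℝ (⊤ : ℕ∞) Ω) (μ lam : ℝ) (hne : lam ≠ μ)
    (hθeq : ∀ x, iteratedDeriv 2 θ x + u x * θ x = μ * θ x)
    (hψeq : ∀ x, iteratedDeriv 2 ψ x + u x * ψ x = lam * ψ x)
    (hΩ : ∀ x, deriv Ω x = θ x ^ 2) (hΩ0 : ∀ x, Ω x ≠ 0) :
    ∀ x : ℝ,
      iteratedDeriv 2
          (fun y => ψ y - θ y * ((θ y * deriv ψ y - deriv θ y * ψ y) / (lam - μ)) / Ω y) x +
        (u x + 2 * deriv (fun y => θ y ^ 2 / Ω y) x) *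
          (ψ x - θ x * ((θ x * deriv ψ x - deriv θ x * ψ x) / (lam - μ)) / Ω x) =
      lam * (ψ x - θ x * ((θ x * deriv ψ x - deriv θ x * ψ x) / (lam - μ)) / Ω x) := by
  intro x
  have hθ2 : ContDiff ℝ 2 θ := contDiff_infty.mp hθ 2
  have hψ2 : ContDiff ℝ 2 ψ := contDiff_infty.mp hψ 2
  have dθ (y : ℝ) : HasDerivAt θ (deriv θ y) y := (hθ2.differentiable two_ne_zero y).hasDerivAt
  have dψ (y : ℝ) : HasDerivAt ψ (deriv ψ y) y := (hψ2.differentiable two_ne_zero y).hasDerivAt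
  have dθ' := hθ2.hasDerivAt_deriv_iteratedDeriv_two x
  have dψ' := hψ2.hasDerivAt_deriv_iteratedDeriv_two x
  have dΩ (y : ℝ) : HasDerivAt Ω (θ y ^ 2) y := by
    rw [← hΩ y]
    exact (hΩs.differentiable (by simp) y).hasDerivAt
  have dW := hasDerivAt_wronskian_div hne hθ2 hψ2 hθeq hψeq
  have hWx : (θ x * deriv ψ x - deriv θ x * ψ x) / (lam - μ) * (lam - μ) =
      θ x * deriv ψ x - deriv θ x * ψ x := div_mul_cancel₀ _ (sub_ne_zero.mpr hne)
  generalize hW : (fun y => (θ y * deriv ψ y - deriv θ y * ψ y) / (lam - μ)) = W at dW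
  have hWy (y : ℝ) : (θ y * deriv ψ y - deriv θ y * ψ y) / (lam - μ) = W y := congrFun hW y
  simp only [hWy] at hWx ⊢
  have d1 (y : ℝ) := (dψ y).sub (((dθ y).mul (dW y)).div (dΩ y) (hΩ0 y))
  have d2 := dψ'.sub (((((dθ'.mul (dW x)).add ((dθ x).mul ((dθ x).mul (dψ x)))).mul (dΩ x)).sub
    (((dθ x).mul (dW x)).mul ((dθ x).pow 2))).div ((dΩ x).pow 2) (pow_ne_zero 2 (hΩ0 x)))
  have dV : deriv (fun y => θ y ^ 2 / Ω y) x = _ := (((dθ x).pow 2).div (dΩ x) (hΩ0 x)).deriv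
  have dG : iteratedDeriv 2 (fun y => ψ y - θ y * W y / Ω y) x = _ :=
    iteratedDeriv_two_eq_of_hasDerivAt d1 d2
  have hΩx := hΩ0 x
  have eθ : iteratedDeriv 2 θ x = μ * θ x - u x * θ x := by linear_combination hθeq x
  have eψ : iteratedDeriv 2 ψ x = lam * ψ x - u x * ψ x := by linear_combination hψeq x
  rw [dG, dV]
  simp only [eθ, eψ, Pi.mul_apply, Pi.pow_apply, Pi.add_apply, Pi.sub_apply]
  field_simp
  linear_combination θ x * Ω x ^ 3 * hWx
end

section
/- Let u, θ, Ω : ℝ → ℝ be infinitely differentiable, let μ ∈ ℝ, and suppose θ'' + uθ = μθ, Ω' = θ², and Ω(x) ≠ 0 for all x. Define û = u + 2·(θ²/Ω)'. Then the function θ̂ = θ/Ω satisfies θ̂'' + û·θ̂ = μ·θ̂; i.e., θ̂ = θΩ⁻¹ is a solution of the binary-Darboux-transformed Schrödinger equation at the same eigenvalue μ. -/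
/-- In the binary Darboux transformation for the self-adjoint Schrödinger
operator: if `θ'' + uθ = μθ`, `Ω' = θ²` and `Ω` is nonvanishing, then
`θ̂ = θ/Ω` satisfies `θ̂'' + ûθ̂ = μθ̂` with `û = u + 2(θ²/Ω)'`. -/
theorem binary_darboux_distinguished_solution (u θ Ω : ℝ → ℝ)
    (hu : ContDiff ℝ (⊤ : ℕ∞) u) (hθ : ContDiff ℝ (⊤ : ℕ∞) θ) (hΩs : ContDiff ℝ (⊤ : ℕ∞) Ω) (μ : ℝ)
    (hθeq : ∀ x, iteratedDeriv 2 θ x + u x * θ x = μ * θ x)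
    (hΩ : ∀ x, deriv Ω x = θ x ^ 2) (hΩ0 : ∀ x, Ω x ≠ 0) :
    ∀ x : ℝ,
      iteratedDeriv 2 (fun y => θ y / Ω y) x +
        (u x + 2 * deriv (fun y => θ y ^ 2 / Ω y) x) * (θ x / Ω x) =
      μ * (θ x / Ω x) := by
  have hθ1 (x) : HasDerivAt θ (deriv θ x) x :=
    ((hθ.differentiable (by simp)) x).hasDerivAt
  have hθ2 (x) : HasDerivAt (deriv θ) (iteratedDeriv 2 θ x) x := by
    have h' := hθ.differentiable_iteratedDeriv 1 (by exact_mod_cast ENat.natCast_lt_top 1) x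
    rw [iteratedDeriv_one] at h'
    simpa only [iteratedDeriv_succ, iteratedDeriv_zero] using h'.hasDerivAt
  have hΩ1 (x) : HasDerivAt Ω (θ x ^ 2) x :=
    hΩ x ▸ ((hΩs.differentiable (by simp)) x).hasDerivAt
  have hquot : deriv (fun y => θ y / Ω y) =
      fun y => (deriv θ y * Ω y - θ y * θ y ^ 2) / Ω y ^ 2 :=
    funext fun y => ((hθ1 y).fun_div (hΩ1 y) (hΩ0 y)).deriv
  intro x
  have hquot2 := (((hθ2 x).fun_mul (hΩ1 x)).fun_sub ((hθ1 x).fun_mul ((hθ1 x).fun_pow 2))).fun_div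
    ((hΩ1 x).fun_pow 2) (pow_ne_zero 2 (hΩ0 x))
  have hsq := ((hθ1 x).fun_pow 2).fun_div (hΩ1 x) (hΩ0 x)
  have hx := hΩ0 x
  rw [iteratedDeriv_succ, iteratedDeriv_one, hquot, hquot2.deriv, hsq.deriv,
    eq_sub_of_add_eq (hθeq x)]
  field_simp
  ring
end

section
/- Fix N ≥ 1 and n ≥ 0. Let u_0, …, u_n : ℝ² → Matrix(Fin N, Fin N, ℂ) be infinitely differentiable matrix coefficient functions of (x, t), and define L(ψ) = ∂_t ψ + Σ_{i=0}^n u_i · ∂_x^i ψ (acting componentwise on vector- or matrix-valued ψ). Let θ : ℝ² → Matrix(Fin N, Fin N, ℂ) be infinitely differentiable with θ(x,t) invertible for every (x,t), and suppose L(θ) = 0. Define the Darboux operator Gψ = ∂_x ψ - (∂_x θ)·θ⁻¹·ψ. Then there exist infinitely differentiable matrix functions ũ_0, …, ũ_n : ℝ² → Matrix(Fin N, Fin N, ℂ) such that for every infinitely differentiable ψ : ℝ² → ℂ^N: ∂_t(Gψ) + Σ_{i=0}^n ũ_i · ∂_x^i (Gψ) = G( ∂_t ψ + Σ_{i=0}^n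 u_i · ∂_x^i ψ ). -/
/-- Entrywise partial `x`-derivative of a matrix-valued function on `ℝ × ℝ`
(coordinates `(x, t)`). -/
noncomputable def mpdX {N : ℕ} (f : ℝ × ℝ → Matrix (Fin N) (Fin N) ℂ) :
    ℝ × ℝ → Matrix (Fin N) (Fin N) ℂ :=
  fun p => Matrix.of fun k l => deriv (fun s => f (s, p.2) k l) p.1

/-- Entrywise partial `t`-derivative of a matrix-valued function on `ℝ × ℝ`. -/
noncomputable def mpdT {N : ℕ} (f : ℝ × ℝ → Matrix (Fin N) (Fin N) ℂ) :
    ℝ × ℝ → Matrix (Fin N) (Fin N) ℂ :=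
  fun p => Matrix.of fun k l => deriv (fun s => f (p.1, s) k l) p.2

/-- Partial `x`-derivative of a vector-valued function on `ℝ × ℝ`. -/
noncomputable def vpdX {N : ℕ} (f : ℝ × ℝ → (Fin N → ℂ)) : ℝ × ℝ → (Fin N → ℂ) :=
  fun p => deriv (fun s => f (s, p.2)) p.1

/-- Partial `t`-derivative of a vector-valued function on `ℝ × ℝ`. -/
noncomputable def vpdT {N : ℕ} (f : ℝ × ℝ → (Fin N → ℂ)) : ℝ × ℝ → (Fin N → ℂ) :=
  fun p => deriv (fun s => f (p.1, s)) p.2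

/-- The left module of linear differential operators `∑_{i < n} c i * X^i` of order `< n` in a
map `X : A → A`. -/
def diffOp {A : Type*} [Ring A] (X : A → A) (n : ℕ) : Submodule A (A → A) :=
  Submodule.span A ((fun i : ℕ => X^[i]) '' (Finset.range n : Finset ℕ))

section DiffOp

variable {A : Type*} [Ring A] {X : A →+ A}

lemma iterate_mem_diffOp (X : A → A) {i n : ℕ} (h : i < n) : X^[i] ∈ diffOp X n :=
  Submodule.subset_span ⟨i, by simpa using h, rfl⟩

lemma diffOp_mono (X : A → A) {m n : ℕ} (h : m ≤ n) : diffOp X m ≤ diffOp X n :=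
  Submodule.span_mono (Set.image_mono (by simpa using h))

lemma diffOp_deriv_comp (hX : ∀ a b, X (a * b) = X a * b + a * X b) {n : ℕ} {E : A → A}
    (hE : E ∈ diffOp X n) : (fun a => X (E a)) ∈ diffOp X (n + 1) := by
  induction hE using Submodule.span_induction with
  | mem E h =>
    obtain ⟨i, hi, rfl⟩ := h
    have hi : i < n := by simpa using hi
    convert iterate_mem_diffOp X (Nat.succ_lt_succ hi) using 1
    funext a
    exact (Function.iterate_succ_apply' X i a).symm
  | zero =>
    convert (diffOp X (n + 1)).zero_mem using 1
    funext a
    simp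
  | add E F _ _ hE hF =>
    convert (diffOp X (n + 1)).add_mem hE hF using 1
    funext a
    simp
  | smul c E hmem hE =>
    have h := (diffOp X (n + 1)).add_mem
      ((diffOp X (n + 1)).smul_mem (X c) (diffOp_mono X n.le_succ hmem))
      ((diffOp X (n + 1)).smul_mem c hE)
    convert h using 1
    funext a
    simp [hX]

lemma iterate_mul_mem_diffOp (hX : ∀ a b, X (a * b) = X a * b + a * X b) (b : A) (i : ℕ) :
    (fun a => X^[i] (b * a)) ∈ diffOp X (i + 1) := by
  induction i with
  | zero => exact (diffOp X 1).smul_mem b (iterate_mem_diffOp X zero_lt_one)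
  | succ i ih =>
    simpa only [Function.iterate_succ_apply'] using diffOp_deriv_comp hX ih

lemma diffOp_comp_mul (hX : ∀ a b, X (a * b) = X a * b + a * X b) (b : A) {n : ℕ} {E : A → A}
    (hE : E ∈ diffOp X n) : (fun a => E (b * a)) ∈ diffOp X n := by
  induction hE using Submodule.span_induction with
  | mem E h =>
    obtain ⟨i, hi, rfl⟩ := h
    have hi : i < n := by simpa using hi
    exact diffOp_mono X hi (iterate_mul_mem_diffOp hX b i)
  | zero => exact (diffOp X n).zero_mem
  | add E F _ _ hE hF => exact (diffOp X n).add_mem hE hF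
  | smul c E _ hE => exact (diffOp X n).smul_mem c hE

/-- Dividing `X^i ∘ θ - (X^i θ)` by `X` on the right. -/
lemma exists_diffOp_iterate_mul (hX : ∀ a b, X (a * b) = X a * b + a * X b) (θ : A) (i : ℕ) :
    ∃ E ∈ diffOp X i, ∀ a, X^[i] (θ * a) = X^[i] θ * a + E (X a) := by
  induction i with
  | zero => exact ⟨0, Submodule.zero_mem _, fun a => by simp⟩
  | succ i ih =>
    obtain ⟨E, hE, h⟩ := ih
    refine ⟨(X^[i] θ) • X^[0] + fun a => X (E a), Submodule.add_mem _
      (Submodule.smul_mem _ _ (iterate_mem_diffOp X i.succ_pos)) (diffOp_deriv_comp hX hE),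
      fun a => ?_⟩
    simp only [Function.iterate_succ_apply', h, map_add, hX]
    simp [add_assoc]

/-- The Darboux transformation in a ring with two commuting derivations. -/
theorem exists_darboux_coeff {T : A →+ A} (hX : ∀ a b, X (a * b) = X a * b + a * X b)
    (hT : ∀ a b, T (a * b) = T a * b + a * T b) (hXT : ∀ a, X (T a) = T (X a))
    (n : ℕ) (u : ℕ → A) (θ θi : A) (h₁ : θ * θi = 1) (h₂ : θi * θ = 1)
    (hθ : T θ + ∑ i ∈ Finset.range (n + 1), u i * X^[i] θ = 0) :
    ∃ v : ℕ → A, ∀ a,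
      T (X a - X θ * θi * a) + ∑ i ∈ Finset.range (n + 1), v i * X^[i] (X a - X θ * θi * a) =
        X (T a + ∑ i ∈ Finset.range (n + 1), u i * X^[i] a) -
          X θ * θi * (T a + ∑ i ∈ Finset.range (n + 1), u i * X^[i] a) := by
  choose E hE hEθ using exists_diffOp_iterate_mul hX θ
  set F : A → A := ∑ i ∈ Finset.range (n + 1), u i • E i with hF
  have hFmem : F ∈ diffOp X n := Submodule.sum_mem _ fun i hi => Submodule.smul_mem _ _
    (diffOp_mono X (Nat.lt_succ_iff.mp (Finset.mem_range.mp hi)) (hE i))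
  have hL (a : A) : T (θ * a) + ∑ i ∈ Finset.range (n + 1), u i * X^[i] (θ * a) =
      θ * T a + F (X a) := by
    simp only [hEθ, hT, mul_add, Finset.sum_add_distrib, ← mul_assoc, ← Finset.sum_mul, hF,
      Finset.sum_apply, Pi.smul_apply, smul_eq_mul]
    have h := congrArg (· * a) hθ
    simp only [add_mul, zero_mul] at h
    rw [← add_assoc, add_right_comm (T θ * a), h, zero_add]
  have hG (a : A) : X a - X θ * θi * a = θ * X (θi * a) := by
    have h : X a = X θ * (θi * a) + θ * X (θi * a) := by rw [← hX, ← mul_assoc, h₁, one_mul]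
    rw [h, mul_assoc]
    abel
  have hmem : (θ * T θi) • X^[0] + θ • (fun a => X (θi * F (θi * a))) ∈ diffOp X (n + 1) :=
    Submodule.add_mem _ (Submodule.smul_mem _ _ (iterate_mem_diffOp X n.succ_pos))
      (Submodule.smul_mem _ _ (diffOp_deriv_comp hX
        (Submodule.smul_mem _ θi (diffOp_comp_mul hX θi hFmem))))
  obtain ⟨v, hv⟩ := (Submodule.mem_span_image_finset_iff_exists_fun' A).mp hmem
  refine ⟨v, fun a => ?_⟩
  have hva := congrFun hv (X a - X θ * θi * a)
  simp only [Finset.sum_apply, Pi.smul_apply, smul_eq_mul, Pi.add_apply,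
    Function.iterate_zero, id] at hva
  rw [hva, hG, hG]
  have hLa := hL (θi * a)
  rw [← mul_assoc, h₁, one_mul] at hLa
  have hi (b : A) : θi * (θ * b) = b := by rw [← mul_assoc, h₂, one_mul]
  have hTi (b : A) : θ * T b = θ * T θi * (θ * b) + T (θ * b) := by
    have h := hT θi (θ * b)
    rw [hi] at h
    rw [h, mul_add, ← mul_assoc, ← mul_assoc θ θi, h₁, one_mul]
  rw [hLa, mul_add, hi, hi, map_add, mul_add, hXT, hTi (X (θi * a))]
  abel

end DiffOp

section PartialDerivatives

variable {f : ℝ × ℝ → ℂ}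

lemma hasDerivAt_slice_fst (hf : Differentiable ℝ f) (p : ℝ × ℝ) :
    HasDerivAt (fun s => f (s, p.2)) (fderiv ℝ f p (1, 0)) p.1 :=
  (hf p).hasFDerivAt.comp_hasDerivAt p.1
    ((hasDerivAt_id p.1).prodMk (hasDerivAt_const p.1 p.2))

lemma hasDerivAt_slice_snd (hf : Differentiable ℝ f) (p : ℝ × ℝ) :
    HasDerivAt (fun s => f (p.1, s)) (fderiv ℝ f p (0, 1)) p.2 :=
  (hf p).hasFDerivAt.comp_hasDerivAt p.2
    ((hasDerivAt_const p.2 p.1).prodMk (hasDerivAt_id p.2))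

lemma contDiff_fderiv_apply_const (hf : ContDiff ℝ (⊤ : ℕ∞) f) (v : ℝ × ℝ) :
    ContDiff ℝ (⊤ : ℕ∞) fun p => fderiv ℝ f p v :=
  (hf.fderiv_right (m := (⊤ : ℕ∞)) (by simp)).clm_apply contDiff_const

lemma fderiv_fderiv_apply_comm (hf : ContDiff ℝ (⊤ : ℕ∞) f) (p v w : ℝ × ℝ) :
    fderiv ℝ (fun q => fderiv ℝ f q v) p w = fderiv ℝ (fun q => fderiv ℝ f q w) p v := by
  have hd : DifferentiableAt ℝ (fderiv ℝ f) p :=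
    (hf.fderiv_right (m := (⊤ : ℕ∞)) (by simp)).differentiable (by simp) p
  have h (a b : ℝ × ℝ) :
      fderiv ℝ (fun q => fderiv ℝ f q a) p b = fderiv ℝ (fderiv ℝ f) p b a := by
    rw [fderiv_clm_apply hd (differentiableAt_const a)]
    simp
  rw [h, h]
  exact hf.contDiffAt.isSymmSndFDerivAt
    (by simpa using WithTop.coe_le_coe.mpr (le_top : (2 : ℕ∞) ≤ ⊤)) w v

end PartialDerivatives

section SmoothMatrix

variable {N : ℕ}

lemma contDiff_matrix_det {θ : ℝ × ℝ → Matrix (Fin N) (Fin N) ℂ}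
    (h : ∀ k l, ContDiff ℝ (⊤ : ℕ∞) fun p => θ p k l) :
    ContDiff ℝ (⊤ : ℕ∞) fun p => (θ p).det := by
  simp only [Matrix.det_apply]
  exact ContDiff.sum fun σ _ => (contDiff_prod fun i _ => h (σ i) i).const_smul (σ.sign : ℤˣ)

lemma contDiff_matrix_inv {θ : ℝ × ℝ → Matrix (Fin N) (Fin N) ℂ}
    (h : ∀ k l, ContDiff ℝ (⊤ : ℕ∞) fun p => θ p k l) (hu : ∀ p, IsUnit (θ p)) (k l : Fin N) :
    ContDiff ℝ (⊤ : ℕ∞) fun p => (θ p)⁻¹ k l := by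
  simp only [Matrix.inv_def, Matrix.smul_apply, smul_eq_mul, Ring.inverse_eq_inv',
    Matrix.adjugate_apply]
  refine ((contDiff_matrix_det h).inv fun p =>
    ((Matrix.isUnit_iff_isUnit_det _).mp (hu p)).ne_zero).mul (contDiff_matrix_det fun i j => ?_)
  by_cases hi : i = l
  · subst hi
    simpa using contDiff_const
  · simpa [Matrix.updateRow_ne hi] using h i j

/-- The ring of smooth matrix-valued functions of `(x, t)`. -/
def smoothMatrix (N : ℕ) : Subring (ℝ × ℝ → Matrix (Fin N) (Fin N) ℂ) where
  carrier := {f | ∀ k l, ContDiff ℝ (⊤ : ℕ∞) fun p => f p k l}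
  mul_mem' hf hg k l := by
    simp only [Pi.mul_apply, Matrix.mul_apply]
    exact ContDiff.sum fun j _ => (hf k j).mul (hg j l)
  one_mem' _ _ := contDiff_const
  add_mem' hf hg k l := (hf k l).add (hg k l)
  zero_mem' _ _ := contDiff_const
  neg_mem' hf k l := (hf k l).neg

lemma differentiable_entry {f : ℝ × ℝ → Matrix (Fin N) (Fin N) ℂ} (hf : f ∈ smoothMatrix N)
    (k l : Fin N) : Differentiable ℝ fun p => f p k l :=
  (hf k l).differentiable (by simp)

lemma mpdX_apply {f : ℝ × ℝ → Matrix (Fin N) (Fin N) ℂ} (hf : f ∈ smoothMatrix N)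
    (p : ℝ × ℝ) (k l : Fin N) : mpdX f p k l = fderiv ℝ (fun q => f q k l) p (1, 0) :=
  (hasDerivAt_slice_fst (differentiable_entry hf k l) p).deriv

lemma mpdT_apply {f : ℝ × ℝ → Matrix (Fin N) (Fin N) ℂ} (hf : f ∈ smoothMatrix N)
    (p : ℝ × ℝ) (k l : Fin N) : mpdT f p k l = fderiv ℝ (fun q => f q k l) p (0, 1) :=
  (hasDerivAt_slice_snd (differentiable_entry hf k l) p).deriv

lemma mpdX_mem {f : ℝ × ℝ → Matrix (Fin N) (Fin N) ℂ} (hf : f ∈ smoothMatrix N) :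
    mpdX f ∈ smoothMatrix N := fun k l => by
  simpa only [mpdX_apply hf] using contDiff_fderiv_apply_const (hf k l) (1, 0)

lemma mpdT_mem {f : ℝ × ℝ → Matrix (Fin N) (Fin N) ℂ} (hf : f ∈ smoothMatrix N) :
    mpdT f ∈ smoothMatrix N := fun k l => by
  simpa only [mpdT_apply hf] using contDiff_fderiv_apply_const (hf k l) (0, 1)

lemma fderiv_add_entry {f g : ℝ × ℝ → Matrix (Fin N) (Fin N) ℂ} (hf : f ∈ smoothMatrix N)
    (hg : g ∈ smoothMatrix N) (p v : ℝ × ℝ) (k l : Fin N) :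
    fderiv ℝ (fun q => (f + g) q k l) p v =
      fderiv ℝ (fun q => f q k l) p v + fderiv ℝ (fun q => g q k l) p v := by
  simp only [Pi.add_apply, Matrix.add_apply]
  rw [fderiv_fun_add (differentiable_entry hf k l p) (differentiable_entry hg k l p)]
  rfl

lemma fderiv_mul_entry {f g : ℝ × ℝ → Matrix (Fin N) (Fin N) ℂ} (hf : f ∈ smoothMatrix N)
    (hg : g ∈ smoothMatrix N) (p v : ℝ × ℝ) (k l : Fin N) :
    fderiv ℝ (fun q => (f * g) q k l) p v =
      ∑ j, fderiv ℝ (fun q => f q k j) p v * g p j l +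
        ∑ j, f p k j * fderiv ℝ (fun q => g q j l) p v := by
  simp only [Pi.mul_apply, Matrix.mul_apply]
  rw [fderiv_fun_sum fun j _ =>
    (differentiable_entry hf k j p).fun_mul (differentiable_entry hg j l p)]
  rw [sum_apply, ← Finset.sum_add_distrib]
  refine Finset.sum_congr rfl fun j _ => ?_
  rw [fderiv_fun_mul (differentiable_entry hf k j p) (differentiable_entry hg j l p)]
  simp only [add_apply, smul_apply, smul_eq_mul]
  ring

/-- `∂_x` on smooth matrix functions. -/
noncomputable def smoothX (N : ℕ) : smoothMatrix N →+ smoothMatrix N :=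
  AddMonoidHom.mk' (fun f => ⟨mpdX f, mpdX_mem f.2⟩) fun f g => by
    ext p k l
    simpa [mpdX_apply, f.2, g.2, mpdX_apply (add_mem f.2 g.2)] using
      fderiv_add_entry f.2 g.2 p (1, 0) k l

/-- `∂_t` on smooth matrix functions. -/
noncomputable def smoothT (N : ℕ) : smoothMatrix N →+ smoothMatrix N :=
  AddMonoidHom.mk' (fun f => ⟨mpdT f, mpdT_mem f.2⟩) fun f g => by
    ext p k l
    simpa [mpdT_apply, f.2, g.2, mpdT_apply (add_mem f.2 g.2)] using
      fderiv_add_entry f.2 g.2 p (0, 1) k l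

lemma coe_smoothX (f : smoothMatrix N) : (smoothX N f : ℝ × ℝ → Matrix (Fin N) (Fin N) ℂ) =
    mpdX (f : ℝ × ℝ → Matrix (Fin N) (Fin N) ℂ) := rfl

lemma coe_smoothT (f : smoothMatrix N) : (smoothT N f : ℝ × ℝ → Matrix (Fin N) (Fin N) ℂ) =
    mpdT (f : ℝ × ℝ → Matrix (Fin N) (Fin N) ℂ) := rfl

lemma coe_smoothX_iterate (i : ℕ) (f : smoothMatrix N) :
    ((smoothX N)^[i] f : ℝ × ℝ → Matrix (Fin N) (Fin N) ℂ) =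
      mpdX^[i] (f : ℝ × ℝ → Matrix (Fin N) (Fin N) ℂ) :=
  Function.Semiconj.iterate_right (f := Subtype.val) (fun f => coe_smoothX f) i f

lemma smoothX_mul (f g : smoothMatrix N) :
    smoothX N (f * g) = smoothX N f * g + f * smoothX N g := by
  ext p k l
  simp only [Subring.coe_add, Subring.coe_mul, coe_smoothX, Pi.add_apply, Pi.mul_apply,
    Matrix.add_apply, Matrix.mul_apply]
  simp only [mpdX_apply f.2, mpdX_apply g.2, mpdX_apply (mul_mem f.2 g.2)]
  exact fderiv_mul_entry f.2 g.2 p (1, 0) k l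

lemma smoothT_mul (f g : smoothMatrix N) :
    smoothT N (f * g) = smoothT N f * g + f * smoothT N g := by
  ext p k l
  simp only [Subring.coe_add, Subring.coe_mul, coe_smoothT, Pi.add_apply, Pi.mul_apply,
    Matrix.add_apply, Matrix.mul_apply]
  simp only [mpdT_apply f.2, mpdT_apply g.2, mpdT_apply (mul_mem f.2 g.2)]
  exact fderiv_mul_entry f.2 g.2 p (0, 1) k l

lemma smoothX_smoothT_comm (f : smoothMatrix N) :
    smoothX N (smoothT N f) = smoothT N (smoothX N f) := by
  ext p k l
  simp only [coe_smoothX, coe_smoothT, mpdX_apply (mpdT_mem f.2), mpdT_apply (mpdX_mem f.2)]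
  simp only [mpdX_apply f.2, mpdT_apply f.2]
  exact fderiv_fderiv_apply_comm (f.2 k l) p (0, 1) (1, 0)

/-- The matrix function all of whose columns are the vector function `ψ`. -/
def colRep (ψ : ℝ × ℝ → Fin N → ℂ) : ℝ × ℝ → Matrix (Fin N) (Fin N) ℂ :=
  fun p => Matrix.of fun k _ => ψ p k

lemma colRep_injective : Function.Injective (colRep (N := N)) := fun _ _ h =>
  funext fun p => funext fun k => congrFun (congrFun (congrFun h p) k) k

lemma colRep_mem_iff {ψ : ℝ × ℝ → Fin N → ℂ} :
    colRep ψ ∈ smoothMatrix N ↔ ContDiff ℝ (⊤ : ℕ∞) ψ :=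
  ⟨fun h => contDiff_pi.mpr fun k => h k k, fun h k _ => contDiff_pi.mp h k⟩

lemma colRep_add (ψ φ : ℝ × ℝ → Fin N → ℂ) :
    colRep (fun q => ψ q + φ q) = colRep ψ + colRep φ := rfl

lemma colRep_sub (ψ φ : ℝ × ℝ → Fin N → ℂ) :
    colRep (fun q => ψ q - φ q) = colRep ψ - colRep φ := rfl

lemma colRep_sum (s : Finset ℕ) (ψ : ℕ → ℝ × ℝ → Fin N → ℂ) :
    colRep (fun q => ∑ i ∈ s, ψ i q) = ∑ i ∈ s, colRep (ψ i) := by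
  ext p k l
  simp [colRep, Finset.sum_apply, Matrix.sum_apply]

lemma colRep_mulVec (a : ℝ × ℝ → Matrix (Fin N) (Fin N) ℂ) (ψ : ℝ × ℝ → Fin N → ℂ) :
    colRep (fun q => (a q).mulVec (ψ q)) = a * colRep ψ := rfl

lemma colRep_vpdX {ψ : ℝ × ℝ → Fin N → ℂ} (h : colRep ψ ∈ smoothMatrix N) :
    colRep (vpdX ψ) = mpdX (colRep ψ) := by
  ext p k l
  exact congrFun (deriv_pi fun j =>
    (hasDerivAt_slice_fst (differentiable_entry h j j) p).differentiableAt) k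

lemma colRep_vpdT {ψ : ℝ × ℝ → Fin N → ℂ} (h : colRep ψ ∈ smoothMatrix N) :
    colRep (vpdT ψ) = mpdT (colRep ψ) := by
  ext p k l
  exact congrFun (deriv_pi fun j =>
    (hasDerivAt_slice_snd (differentiable_entry h j j) p).differentiableAt) k

lemma colRep_vpdX_iterate {ψ : ℝ × ℝ → Fin N → ℂ} (h : colRep ψ ∈ smoothMatrix N) (i : ℕ) :
    colRep (vpdX^[i] ψ) = ((smoothX N)^[i] ⟨colRep ψ, h⟩ : smoothMatrix N) := by
  induction i with
  | zero => rfl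
  | succ i ih =>
    rw [Function.iterate_succ_apply', Function.iterate_succ_apply', coe_smoothX, ← ih,
      colRep_vpdX (ih ▸ Subtype.property _)]

end SmoothMatrix

/-- Matveev's Darboux transformation for `L = ∂_t + Σ_{i=0}^n u_i ∂_x^i` with
`N×N` matrix coefficients.  Given an everywhere-invertible matrix solution `θ`
of `L(θ) = 0`, the gauge operator `Gψ = ψ_x - θ_x θ⁻¹ ψ` intertwines `L` with
an operator `L̃ = ∂_t + Σ_{i=0}^n ũ_i ∂_x^i` of the same form:
`L̃(Gψ) = G(L(ψ))` for every smooth `ψ`. -/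
theorem matveev_darboux (N n : ℕ) (hN : 1 ≤ N)
    (u : ℕ → ℝ × ℝ → Matrix (Fin N) (Fin N) ℂ)
    (hu : ∀ i ∈ Finset.range (n + 1), ∀ k l : Fin N, ContDiff ℝ (⊤ : ℕ∞) fun p => u i p k l)
    (θ : ℝ × ℝ → Matrix (Fin N) (Fin N) ℂ)
    (hθs : ∀ k l : Fin N, ContDiff ℝ (⊤ : ℕ∞) fun p => θ p k l)
    (hθinv : ∀ p : ℝ × ℝ, IsUnit (θ p))
    (hθL : ∀ p : ℝ × ℝ,
      mpdT θ p + ∑ i ∈ Finset.range (n + 1), u i p * (mpdX^[i] θ) p = 0) :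
    ∃ ut : ℕ → ℝ × ℝ → Matrix (Fin N) (Fin N) ℂ,
      (∀ i ∈ Finset.range (n + 1), ∀ k l : Fin N, ContDiff ℝ (⊤ : ℕ∞) fun p => ut i p k l) ∧
      ∀ ψ : ℝ × ℝ → (Fin N → ℂ), ContDiff ℝ (⊤ : ℕ∞) ψ →
        ∀ p : ℝ × ℝ,
          vpdT (fun q => vpdX ψ q - (mpdX θ q * (θ q)⁻¹).mulVec (ψ q)) p +
              ∑ i ∈ Finset.range (n + 1),
                (ut i p).mulVec
                  ((vpdX^[i] fun q => vpdX ψ q - (mpdX θ q * (θ q)⁻¹).mulVec (ψ q)) p) =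
            vpdX (fun q => vpdT ψ q +
                ∑ i ∈ Finset.range (n + 1), (u i q).mulVec ((vpdX^[i] ψ) q)) p -
              (mpdX θ p * (θ p)⁻¹).mulVec
                (vpdT ψ p +
                  ∑ i ∈ Finset.range (n + 1), (u i p).mulVec ((vpdX^[i] ψ) p)) := by
  let U : ℕ → smoothMatrix N := fun i => if h : i ∈ Finset.range (n + 1) then ⟨u i, hu i h⟩ else 0
  have hU {i : ℕ} (h : i ∈ Finset.range (n + 1)) : (U i : ℝ × ℝ → _) = u i := by
    simp only [U, dif_pos h]
  let Θ : smoothMatrix N := ⟨θ, hθs⟩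
  let Θi : smoothMatrix N := ⟨fun p => (θ p)⁻¹, contDiff_matrix_inv hθs hθinv⟩
  have hdet (p : ℝ × ℝ) : IsUnit (θ p).det := (Matrix.isUnit_iff_isUnit_det _).mp (hθinv p)
  have h₁ : Θ * Θi = 1 := Subtype.ext (funext fun p => Matrix.mul_nonsing_inv _ (hdet p))
  have h₂ : Θi * Θ = 1 := Subtype.ext (funext fun p => Matrix.nonsing_inv_mul _ (hdet p))
  have hLΘ : smoothT N Θ + ∑ i ∈ Finset.range (n + 1), U i * (smoothX N)^[i] Θ = 0 := by
    refine Subtype.ext (funext fun p => (Eq.trans ?_ (hθL p)))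
    simp only [Subring.coe_add, AddSubmonoidClass.coe_finsetSum, Subring.coe_mul, coe_smoothT,
      coe_smoothX_iterate, Pi.add_apply, Finset.sum_apply, Pi.mul_apply]
    exact congrArg _ (Finset.sum_congr rfl fun i hi => by rw [hU hi])
  obtain ⟨v, hv⟩ := exists_darboux_coeff smoothX_mul smoothT_mul smoothX_smoothT_comm n U Θ Θi
    h₁ h₂ hLΘ
  refine ⟨fun i => v i, fun i _ => (v i).2, fun ψ hψ => congrFun (colRep_injective ?_)⟩
  have hψ' := colRep_mem_iff.mpr hψ
  let Ψ : smoothMatrix N := ⟨colRep ψ, hψ'⟩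
  let g : ℝ × ℝ → Fin N → ℂ := fun q => vpdX ψ q - (mpdX θ q * (θ q)⁻¹).mulVec (ψ q)
  let l : ℝ × ℝ → Fin N → ℂ := fun q => vpdT ψ q +
    ∑ i ∈ Finset.range (n + 1), (u i q).mulVec ((vpdX^[i] ψ) q)
  have hg : colRep g = (smoothX N Ψ - smoothX N Θ * Θi * Ψ : smoothMatrix N) := by
    rw [colRep_sub, colRep_vpdX hψ', colRep_mulVec]
    rfl
  have hl : colRep l =
      (smoothT N Ψ + ∑ i ∈ Finset.range (n + 1), U i * (smoothX N)^[i] Ψ : smoothMatrix N) := by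
    rw [colRep_add, colRep_vpdT hψ', colRep_sum, Subring.coe_add,
      AddSubmonoidClass.coe_finsetSum]
    refine congrArg _ (Finset.sum_congr rfl fun i hi => ?_)
    rw [colRep_mulVec, colRep_vpdX_iterate hψ', Subring.coe_mul, hU hi]
  have hgmem : colRep g ∈ smoothMatrix N := hg ▸ Subtype.property _
  have hlmem : colRep l ∈ smoothMatrix N := hl ▸ Subtype.property _
  have hΨ := congrArg Subtype.val (hv Ψ)
  rw [← show (⟨colRep g, hgmem⟩ : smoothMatrix N) = _ from Subtype.ext hg,
    ← show (⟨colRep l, hlmem⟩ : smoothMatrix N) = _ from Subtype.ext hl] at hΨ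
  calc colRep (fun p => vpdT g p +
          ∑ i ∈ Finset.range (n + 1), ((v i).1 p).mulVec ((vpdX^[i] g) p))
      = (smoothT N ⟨colRep g, hgmem⟩ + ∑ i ∈ Finset.range (n + 1),
          v i * (smoothX N)^[i] ⟨colRep g, hgmem⟩ : smoothMatrix N) := by
        rw [colRep_add, colRep_vpdT hgmem, colRep_sum]
        simp only [colRep_mulVec, colRep_vpdX_iterate hgmem]
        rw [Subring.coe_add, AddSubmonoidClass.coe_finsetSum]
        rfl
    _ = _ := hΨ
    _ = colRep (fun p => vpdX l p - (mpdX θ p * (θ p)⁻¹).mulVec (l p)) := by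
        rw [colRep_sub, colRep_vpdX hlmem, colRep_mulVec]
        rfl
end

section
/- Fix N ≥ 1 and n ≥ 1. Let u_1, …, u_n : ℝ² → Matrix(Fin N, Fin N, ℂ) be infinitely differentiable matrix coefficient functions of (x, t), and define L(ψ) = ∂_t ψ + Σ_{i=1}^n u_i · ∂_x^i ψ (note: no multiplicative i = 0 term). Let θ : ℝ² → Matrix(Fin N, Fin N, ℂ) be infinitely differentiable with θ(x,t) invertible for every (x,t), and suppose L(θ) = 0. Then there exist infinitely differentiable matrix functions ũ_1, …, ũ_n : ℝ² → Matrix(Fin N, Fin N, ℂ) such that for every infinitely differentiable ψ : ℝ² → ℂ^N: ∂_t(θ⁻¹ψ) + Σ_{i=1}^n ũ_i · ∂_x^i (θ⁻¹ψ) = θ⁻¹·( ∂_t ψ + Σ_{i=1}^n u_i · ∂_x^i ψ ). In particular the transformed operator again has no multiplicative (order-zero) term. -/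
section MatrixCalculus

open Matrix

variable {N : ℕ}

theorem hasDerivAt_mulVec {A : ℝ → Matrix (Fin N) (Fin N) ℂ} {A' : Matrix (Fin N) (Fin N) ℂ}
    {v : ℝ → Fin N → ℂ} {v' : Fin N → ℂ} {x : ℝ}
    (hA : ∀ k l, HasDerivAt (fun s => A s k l) (A' k l) x) (hv : HasDerivAt v v' x) :
    HasDerivAt (fun s => A s *ᵥ v s) (A' *ᵥ v x + A x *ᵥ v') x := by
  rw [hasDerivAt_pi] at hv ⊢
  intro k
  simp only [mulVec, dotProduct, Pi.add_apply, ← Finset.sum_add_distrib]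
  exact HasDerivAt.fun_sum fun l _ => (hA k l).mul (hv l)

theorem ContDiff.mulVec_of_entries {E : Type*} [NormedAddCommGroup E] [NormedSpace ℝ E]
    {m : WithTop ℕ∞} {A : E → Matrix (Fin N) (Fin N) ℂ} {v : E → Fin N → ℂ}
    (hA : ∀ k l, ContDiff ℝ m fun p => A p k l) (hv : ContDiff ℝ m v) :
    ContDiff ℝ m fun p => A p *ᵥ v p := by
  rw [contDiff_pi] at hv ⊢
  intro k
  simp only [mulVec, dotProduct]
  exact ContDiff.sum fun l _ => (hA k l).mul (hv l)

theorem ContDiff.matrix_mul_of_entries {E : Type*} [NormedAddCommGroup E] [NormedSpace ℝ E]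
    {m : WithTop ℕ∞} {A B : E → Matrix (Fin N) (Fin N) ℂ}
    (hA : ∀ k l, ContDiff ℝ m fun p => A p k l) (hB : ∀ k l, ContDiff ℝ m fun p => B p k l)
    (k l : Fin N) : ContDiff ℝ m fun p => (A p * B p) k l := by
  simp only [mul_apply]
  exact ContDiff.sum fun j _ => (hA k j).mul (hB j l)

theorem ContDiff.matrix_det_of_entries {E : Type*} [NormedAddCommGroup E] [NormedSpace ℝ E]
    {m : WithTop ℕ∞} {A : E → Matrix (Fin N) (Fin N) ℂ}
    (hA : ∀ k l, ContDiff ℝ m fun p => A p k l) : ContDiff ℝ m fun p => (A p).det := by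
  simp only [det_apply']
  exact ContDiff.sum fun σ _ => contDiff_const.mul (contDiff_prod fun i _ => hA (σ i) i)

theorem ContDiff.matrix_inv_of_entries {E : Type*} [NormedAddCommGroup E] [NormedSpace ℝ E]
    {m : WithTop ℕ∞} {A : E → Matrix (Fin N) (Fin N) ℂ}
    (hA : ∀ k l, ContDiff ℝ m fun p => A p k l) (hinv : ∀ p, IsUnit (A p)) (k l : Fin N) :
    ContDiff ℝ m fun p => (A p)⁻¹ k l := by
  simp only [inv_def, Matrix.smul_apply, smul_eq_mul, Ring.inverse_eq_inv', adjugate_apply]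
  refine ((matrix_det_of_entries hA).inv fun p => ?_).mul (matrix_det_of_entries fun i j => ?_)
  · exact ((isUnit_iff_isUnit_det _).1 (hinv p)).ne_zero
  · by_cases h : i = l
    · subst h
      simpa only [updateRow_self] using contDiff_const
    · simpa only [updateRow_ne h] using hA i j

theorem contDiff_deriv_fst {F : Type*} [NormedAddCommGroup F] [NormedSpace ℝ F] {f : ℝ × ℝ → F}
    (hf : ContDiff ℝ (⊤ : ℕ∞) f) :
    ContDiff ℝ (⊤ : ℕ∞) fun p : ℝ × ℝ => deriv (fun s => f (s, p.2)) p.1 := by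
  have h (p : ℝ × ℝ) : deriv (fun s => f (s, p.2)) p.1 = fderiv ℝ f p (1, 0) :=
    (((hf.differentiable (by simp)) p).hasFDerivAt.comp_hasDerivAt p.1
      ((hasDerivAt_id p.1).prodMk (hasDerivAt_const p.1 p.2))).deriv
  simp only [h]
  exact (hf.fderiv_right (m := (⊤ : ℕ∞)) (by simp)).clm_apply contDiff_const

theorem contDiff_iterate_mpdX {A : ℝ × ℝ → Matrix (Fin N) (Fin N) ℂ}
    (hA : ∀ k l, ContDiff ℝ (⊤ : ℕ∞) fun p => A p k l) (i : ℕ) (k l : Fin N) :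
    ContDiff ℝ (⊤ : ℕ∞) fun p => (mpdX^[i] A) p k l := by
  induction i generalizing k l with
  | zero => exact hA k l
  | succ i ih =>
    rw [Function.iterate_succ_apply']
    exact contDiff_deriv_fst (ih k l)

theorem contDiff_iterate_vpdX {v : ℝ × ℝ → Fin N → ℂ} (hv : ContDiff ℝ (⊤ : ℕ∞) v) (i : ℕ) :
    ContDiff ℝ (⊤ : ℕ∞) (vpdX^[i] v) := by
  induction i with
  | zero => exact hv
  | succ i ih =>
    rw [Function.iterate_succ_apply']
    exact contDiff_deriv_fst ih

theorem ContDiff.hasDerivAt_fst_slice {F : Type*} [NormedAddCommGroup F] [NormedSpace ℝ F]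
    {f : ℝ × ℝ → F} (hf : ContDiff ℝ (⊤ : ℕ∞) f) (p : ℝ × ℝ) :
    HasDerivAt (fun s => f (s, p.2)) (deriv (fun s => f (s, p.2)) p.1) p.1 :=
  (((hf.comp (contDiff_prodMk_left p.2)).differentiable (by simp)) p.1).hasDerivAt

theorem ContDiff.hasDerivAt_snd_slice {F : Type*} [NormedAddCommGroup F] [NormedSpace ℝ F]
    {f : ℝ × ℝ → F} (hf : ContDiff ℝ (⊤ : ℕ∞) f) (p : ℝ × ℝ) :
    HasDerivAt (fun s => f (p.1, s)) (deriv (fun s => f (p.1, s)) p.2) p.2 :=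
  (((hf.comp (contDiff_prodMk_right p.1)).differentiable (by simp)) p.2).hasDerivAt

theorem vpdT_mulVec {A : ℝ × ℝ → Matrix (Fin N) (Fin N) ℂ} {v : ℝ × ℝ → Fin N → ℂ}
    (hA : ∀ k l, ContDiff ℝ (⊤ : ℕ∞) fun p => A p k l) (hv : ContDiff ℝ (⊤ : ℕ∞) v)
    (p : ℝ × ℝ) :
    vpdT (fun q => A q *ᵥ v q) p = mpdT A p *ᵥ v p + A p *ᵥ vpdT v p :=
  (hasDerivAt_mulVec (A' := mpdT A p) (fun k l => (hA k l).hasDerivAt_snd_slice p)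
    (hv.hasDerivAt_snd_slice p)).deriv

/-- Leibniz rule for iterated `x`-derivatives of a matrix-vector product. -/
theorem iterate_vpdX_mulVec {A : ℝ × ℝ → Matrix (Fin N) (Fin N) ℂ} {v : ℝ × ℝ → Fin N → ℂ}
    (hA : ∀ k l, ContDiff ℝ (⊤ : ℕ∞) fun p => A p k l) (hv : ContDiff ℝ (⊤ : ℕ∞) v) (i : ℕ) :
    (vpdX^[i] fun q => A q *ᵥ v q) = fun p => ∑ ab ∈ Finset.HasAntidiagonal.antidiagonal i,
      i.choose ab.1 • ((mpdX^[ab.2] A) p *ᵥ (vpdX^[ab.1] v) p) := by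
  induction i with
  | zero => simp
  | succ i ih =>
    rw [Function.iterate_succ_apply', ih]
    funext p
    rw [Finset.sum_antidiagonal_choose_succ_nsmul
      (fun a b => (mpdX^[b] A) p *ᵥ (vpdX^[a] v) p) i, ← Finset.sum_add_distrib]
    refine (HasDerivAt.fun_sum fun ab _ => ((hasDerivAt_mulVec (A' := (mpdX^[ab.2 + 1] A) p)
      (v' := (vpdX^[ab.1 + 1] v) p) (fun k l => ?_) ?_).const_smul (i.choose ab.1))).deriv.trans ?_
    · rw [Function.iterate_succ_apply']
      exact (contDiff_iterate_mpdX hA ab.2 k l).hasDerivAt_fst_slice p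
    · rw [Function.iterate_succ_apply']
      exact (contDiff_iterate_vpdX hv ab.1).hasDerivAt_fst_slice p
    · refine Finset.sum_congr rfl fun ab hab => ?_
      rw [smul_add, Nat.choose_symm_of_eq_add (Finset.HasAntidiagonal.mem_antidiagonal.1 hab).symm]

theorem iterate_vpdX_mulVec_eq_add_sum_Icc {A : ℝ × ℝ → Matrix (Fin N) (Fin N) ℂ}
    {v : ℝ × ℝ → Fin N → ℂ} (hA : ∀ k l, ContDiff ℝ (⊤ : ℕ∞) fun p => A p k l)
    (hv : ContDiff ℝ (⊤ : ℕ∞) v) {i n : ℕ} (hi : i ≤ n) (p : ℝ × ℝ) :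
    (vpdX^[i] fun q => A q *ᵥ v q) p = (mpdX^[i] A) p *ᵥ v p +
      ∑ k ∈ Finset.Icc 1 n, i.choose k • ((mpdX^[i - k] A) p *ᵥ (vpdX^[k] v) p) := by
  rw [iterate_vpdX_mulVec hA hv]
  dsimp only
  rw [Finset.Nat.sum_antidiagonal_eq_sum_range_succ
    (fun a b => i.choose a • ((mpdX^[b] A) p *ᵥ (vpdX^[a] v) p)) i,
    Finset.sum_subset (Finset.range_subset_range.2 (Nat.succ_le_succ hi)), Finset.range_eq_Ico,
    Finset.sum_eq_sum_Ico_succ_bot n.succ_pos]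
  · simp
    rfl
  · intro k _ hk
    rw [Nat.choose_eq_zero_of_lt (by simpa using hk), zero_smul]

end MatrixCalculus

/-- First elementary Darboux transformation `G = θ⁻¹` for matrix operators
`L = ∂_t + Σ_{i=1}^n u_i ∂_x^i` without multiplicative term.  Given an
everywhere-invertible matrix solution `θ` of `L(θ) = 0`, conjugation by
`θ⁻¹` yields an operator of the same form (again with no order-zero term):
`L̃(θ⁻¹ψ) = θ⁻¹ L(ψ)` for every smooth `ψ`. -/
theorem elementary_darboux_one (N n : ℕ) (hN : 1 ≤ N) (hn : 1 ≤ n)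
    (u : ℕ → ℝ × ℝ → Matrix (Fin N) (Fin N) ℂ)
    (hu : ∀ i ∈ Finset.Icc 1 n, ∀ k l : Fin N, ContDiff ℝ (⊤ : ℕ∞) fun p => u i p k l)
    (θ : ℝ × ℝ → Matrix (Fin N) (Fin N) ℂ)
    (hθs : ∀ k l : Fin N, ContDiff ℝ (⊤ : ℕ∞) fun p => θ p k l)
    (hθinv : ∀ p : ℝ × ℝ, IsUnit (θ p))
    (hθL : ∀ p : ℝ × ℝ,
      mpdT θ p + ∑ i ∈ Finset.Icc 1 n, u i p * (mpdX^[i] θ) p = 0) :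
    ∃ ut : ℕ → ℝ × ℝ → Matrix (Fin N) (Fin N) ℂ,
      (∀ i ∈ Finset.Icc 1 n, ∀ k l : Fin N, ContDiff ℝ (⊤ : ℕ∞) fun p => ut i p k l) ∧
      ∀ ψ : ℝ × ℝ → (Fin N → ℂ), ContDiff ℝ (⊤ : ℕ∞) ψ →
        ∀ p : ℝ × ℝ,
          vpdT (fun q => ((θ q)⁻¹).mulVec (ψ q)) p +
              ∑ i ∈ Finset.Icc 1 n,
                (ut i p).mulVec ((vpdX^[i] fun q => ((θ q)⁻¹).mulVec (ψ q)) p) =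
            ((θ p)⁻¹).mulVec
              (vpdT ψ p +
                ∑ i ∈ Finset.Icc 1 n, (u i p).mulVec ((vpdX^[i] ψ) p)) := by
  have hinv := ContDiff.matrix_inv_of_entries hθs hθinv
  have hdet (p : ℝ × ℝ) : IsUnit (θ p).det := (Matrix.isUnit_iff_isUnit_det _).1 (hθinv p)
  refine ⟨fun k p => (θ p)⁻¹ * ∑ i ∈ Finset.Icc 1 n, i.choose k • (u i p * (mpdX^[i - k] θ) p),
    fun k _ => ContDiff.matrix_mul_of_entries hinv fun a b => ?_, fun ψ hψ p => ?_⟩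
  · simp only [Matrix.sum_apply, Matrix.smul_apply]
    exact ContDiff.sum fun i hi => (ContDiff.matrix_mul_of_entries (hu i hi)
      (contDiff_iterate_mpdX hθs (i - k)) a b).const_smul (i.choose k)
  obtain ⟨v, hvψ⟩ : ∃ v : ℝ × ℝ → Fin N → ℂ, v = fun q => ((θ q)⁻¹).mulVec (ψ q) := ⟨_, rfl⟩
  have hv : ContDiff ℝ (⊤ : ℕ∞) v := hvψ ▸ ContDiff.mulVec_of_entries hinv hψ
  have hψv : ψ = fun q => (θ q).mulVec (v q) := by
    funext q
    rw [hvψ, Matrix.mulVec_mulVec, Matrix.mul_nonsing_inv _ (hdet q), Matrix.one_mulVec]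
  have hL : (mpdT θ p).mulVec (v p) +
      ∑ i ∈ Finset.Icc 1 n, (u i p).mulVec (((mpdX^[i] θ) p).mulVec (v p)) = 0 := by
    simpa only [Matrix.add_mulVec, Matrix.sum_mulVec, Matrix.mulVec_mulVec, Matrix.zero_mulVec]
      using congrArg (fun M => Matrix.mulVec M (v p)) (hθL p)
  have hsum : ∑ i ∈ Finset.Icc 1 n, (u i p).mulVec ((vpdX^[i] ψ) p) =
      ∑ i ∈ Finset.Icc 1 n, (u i p).mulVec (((mpdX^[i] θ) p).mulVec (v p)) +
        ∑ k ∈ Finset.Icc 1 n, (∑ i ∈ Finset.Icc 1 n,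
          i.choose k • (u i p * (mpdX^[i - k] θ) p)).mulVec ((vpdX^[k] v) p) := by
    simp only [Matrix.sum_mulVec]
    rw [Finset.sum_comm, ← Finset.sum_add_distrib]
    refine Finset.sum_congr rfl fun i hi => ?_
    rw [hψv, iterate_vpdX_mulVec_eq_add_sum_Icc hθs hv (Finset.mem_Icc.1 hi).2,
      Matrix.mulVec_add, Matrix.mulVec_sum]
    simp only [Matrix.mulVec_smul, Matrix.smul_mulVec, Matrix.mulVec_mulVec]
  have hT : vpdT ψ p = (mpdT θ p).mulVec (v p) + (θ p).mulVec (vpdT v p) := by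
    rw [hψv, vpdT_mulVec hθs hv]
  rw [← hvψ, hsum, hT, add_add_add_comm, hL, zero_add, Matrix.mulVec_add, Matrix.mulVec_mulVec,
    Matrix.nonsing_inv_mul _ (hdet p), Matrix.one_mulVec, Matrix.mulVec_sum]
  simp only [Matrix.mulVec_mulVec]
end
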